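/- Let (S; ·, \, /) be an algebra satisfying system (A) together with the identity (x \ x)·y = y (i.e., S is a right product loop). Then for every idempotent e ∈ S (i.e., e·e = e) and all x, y ∈ S, one has x·(y·e) = (x·y)·e. -/

import Mathlib

/-- In an algebra satisfying system (A) together with `(x\x)·y = y`
(a right product loop), for every idempotent `e` and all `x, y`,
`x·(y·e) = (x·y)·e`. -/
theorem rightProductLoop_idempotent_assoc {S : Type*} (mul ld rd : S → S → S)
    (A1 : ∀ x y : S, ld x (mul x y) = y)
    (A2 : ∀ x y : S, mul x (ld x y) = y)
    (A3 : ∀ x y : S, mul (rd x y) y = rd (mul x y) y)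
    (A4 : ∀ x y z : S, rd (mul (rd x y) y) z = rd x z)
    (A5 : ∀ x y z : S, mul (rd (mul x y) z) z = mul x (mul (rd y z) z))
    (L : ∀ x y : S, mul (ld x x) y = y) :
    ∀ e x y : S, mul e e = e → mul x (mul y e) = mul (mul x y) e := by
  intro e x y he
  have idl : ∀ u : S, mul u u = u → ∀ z, mul u z = z := by
    intro u hu z
    have h1 : ld u u = u := by
      have h := A1 u u
      rwa [hu] at h
    have h2 := L u z
    rwa [h1] at h2
  have hu1 : mul (rd e e) e = rd e e := by rw [A3, he]
  -- `(x/e)·e = x·(e/e)`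
  have hp : ∀ x : S, mul (rd x e) e = mul x (rd e e) := by
    intro x
    have h := A5 x (ld x x) e
    rw [A2, A3 (ld x x) e, L] at h
    exact h
  have huu : mul (rd e e) (rd e e) = rd e e := by
    rw [← hp]
    have h := A4 e e e
    rw [hu1] at h
    rw [h, hu1]
  have hue : rd e e = e := by
    rw [← hu1]
    exact idl _ huu e
  rw [hue] at hp
  rw [← hp y, ← hp (mul x y), A5]
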